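/- arXiv:1503.07310 — 2 statements merged into one kernel-verified Lean document; each statement's English description precedes it below -/
import Mathlib

section
/- Let a, b be arbitrary distinct elements of 𝕃. Then the structure ({0,1}; NAE) has a primitive positive interpretation in the structure (𝕃; N, a, b), i.e., in the expansion of (𝕃;N) by the constants a and b. -/
/-! ### Relational structures and primitive positive formulas -/

/-- A relational structure with relation symbols `σ`, arities `ar`, and domain `D`. -/
structure RelStruct (σ : Type) (ar : σ → ℕ) (D : Type) where
  rel : (s : σ) → (Fin (ar s) → D) → Prop

/-- Primitive positive formulas over the relational signature `(σ, ar)`, with `n` free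
variables (built from atomic formulas using only conjunction and existential
quantification). -/
inductive PPFormula (σ : Type) (ar : σ → ℕ) : ℕ → Type
  | eq {n : ℕ} (i j : Fin n) : PPFormula σ ar n
  | rel {n : ℕ} (s : σ) (v : Fin (ar s) → Fin n) : PPFormula σ ar n
  | and {n : ℕ} (φ ψ : PPFormula σ ar n) : PPFormula σ ar n
  | ex {n : ℕ} (φ : PPFormula σ ar (n + 1)) : PPFormula σ ar n

/-- Satisfaction of a primitive positive formula in a structure, under an assignment. -/
def PPFormula.Realize {σ : Type} {ar : σ → ℕ} {D : Type} (Γ : RelStruct σ ar D) :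
    {n : ℕ} → PPFormula σ ar n → (Fin n → D) → Prop
  | _, .eq i j, t => t i = t j
  | _, .rel s v, t => Γ.rel s (fun m => t (v m))
  | _, .and φ ψ, t => φ.Realize Γ t ∧ ψ.Realize Γ t
  | _, .ex φ, t => ∃ d : D, φ.Realize Γ (Fin.snoc t d)

/-- A relation is primitive positive definable in `Γ` if it is the set of solutions of a
primitive positive formula over the signature of `Γ`. -/
def PPDefinable {σ : Type} {ar : σ → ℕ} {D : Type} (Γ : RelStruct σ ar D) {n : ℕ}
    (R : (Fin n → D) → Prop) : Prop :=
  ∃ φ : PPFormula σ ar n, ∀ t, R t ↔ φ.Realize Γ t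

/-- The expansion of a structure by the constants `a 0, …, a (n-1)`, realised as new
singleton unary relations. -/
def RelStruct.withConstants {σ : Type} {ar : σ → ℕ} {D : Type} (Γ : RelStruct σ ar D)
    {n : ℕ} (a : Fin n → D) : RelStruct (σ ⊕ Fin n) (Sum.elim ar fun _ => 1) D where
  rel s := match s with
    | .inl s => fun t => Γ.rel s t
    | .inr i => fun t : Fin 1 → D => t 0 = a i

/-- Flattening a `k`-tuple of `d`-tuples into a `(k*d)`-tuple. -/
def flattenTuple {D : Type} {k d : ℕ} (ts : Fin k → Fin d → D) : Fin (k * d) → D :=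
  fun j => ts (finProdFinEquiv.symm j).1 (finProdFinEquiv.symm j).2

/-- A primitive positive interpretation of the structure `Δ` in the structure `Γ`:
a dimension `dim`, a primitive positive domain formula, primitive positive defining
formulas for equality and for each atomic formula, and a coordinate map, surjective
onto `Δ`, from the `dim`-tuples satisfying the domain formula. -/
structure PPInterpretation {σ₁ : Type} {ar₁ : σ₁ → ℕ} {D : Type} (Γ : RelStruct σ₁ ar₁ D)
    {σ₂ : Type} {ar₂ : σ₂ → ℕ} {E : Type} (Δ : RelStruct σ₂ ar₂ E) : Type where
  dim : ℕ
  domFml : PPFormula σ₁ ar₁ dim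
  eqFml : PPFormula σ₁ ar₁ (2 * dim)
  relFml : (s : σ₂) → PPFormula σ₁ ar₁ (ar₂ s * dim)
  coord : (Fin dim → D) → E
  coord_surj : ∀ e : E, ∃ t, domFml.Realize Γ t ∧ coord t = e
  eq_iff : ∀ t₁ t₂ : Fin dim → D, domFml.Realize Γ t₁ → domFml.Realize Γ t₂ →
    (coord t₁ = coord t₂ ↔ eqFml.Realize Γ (flattenTuple ![t₁, t₂]))
  rel_iff : ∀ (s : σ₂) (ts : Fin (ar₂ s) → Fin dim → D),
    (∀ i, domFml.Realize Γ (ts i)) →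
    (Δ.rel s (fun i => coord (ts i)) ↔ (relFml s).Realize Γ (flattenTuple ts))

/-- The Boolean structure `({0,1}; NAE)`, where `NAE = {0,1}³ \ {(0,0,0),(1,1,1)}`. -/
def NAEStruct : RelStruct Unit (fun _ => 3) Bool where
  rel := fun _ t => (∃ i, t i = true) ∧ (∃ i, t i = false)
/-! ### C-relations

`C z x y` encodes `C(z; x, y)`, also written `xy|z`: the smallest subtree containing
`x` and `y` does not contain `z`. -/

/-- The Adeleke–Neumann axioms for a C-relation. -/
def IsCRelation {L : Type} (C : L → L → L → Prop) : Prop :=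
  (∀ z x y, C z x y → C z y x) ∧
  (∀ z x y, C z x y → ¬ C y x z) ∧
  (∀ z x y, C z x y → ∀ w, C w x y ∨ C z w y) ∧
  (∀ z x, x ≠ z → C z x x)

/-- A C-relation is binary branching if for pairwise distinct `x, y, z` one of the three
groupings `xy|z`, `xz|y`, `yz|x` holds (by the axioms, exactly one then holds). -/
def IsBinaryBranching {L : Type} (C : L → L → L → Prop) : Prop :=
  ∀ x y z : L, x ≠ y → x ≠ z → y ≠ z → C z x y ∨ C y x z ∨ C x y z

/-- Density of a C-relation. -/
def IsDenseC {L : Type} (C : L → L → L → Prop) : Prop :=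
  ∀ x y z, C x y z → ∃ w, C x w z ∧ C w y z

/-- An automorphism of `(L; C)`. -/
def IsCAutomorphism {L : Type} (C : L → L → L → Prop) (g : L → L) : Prop :=
  Function.Bijective g ∧ ∀ z x y, C (g z) (g x) (g y) ↔ C z x y

/-- `(L; C)` is homogeneous: every isomorphism between finite induced substructures
extends to an automorphism. -/
def IsCHomogeneous {L : Type} (C : L → L → L → Prop) : Prop :=
  ∀ (A : Finset L) (f : L → L), Set.InjOn f ↑A →
    (∀ z ∈ A, ∀ x ∈ A, ∀ y ∈ A, C z x y ↔ C (f z) (f x) (f y)) →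
    ∃ g : L → L, IsCAutomorphism C g ∧ ∀ a ∈ A, g a = f a

/-- `(L; C)` is (isomorphic to) the countable homogeneous binary branching dense
C-relation `(𝕃; C)`. -/
def IsHomBBDenseC {L : Type} (C : L → L → L → Prop) : Prop :=
  Countable L ∧ Infinite L ∧ IsCRelation C ∧ IsBinaryBranching C ∧
    IsDenseC C ∧ IsCHomogeneous C

/-- The relation `N(x,y,z)` iff `xy|z` or `x|yz`. -/
def NRel {L : Type} (C : L → L → L → Prop) (x y z : L) : Prop := C z x y ∨ C x y z

/-- The quartet relation `Q(x,y,z,t)` iff (`xy|z` and `xy|t`) or (`zt|x` and `zt|y`). -/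
def QRel {L : Type} (C : L → L → L → Prop) (x y z t : L) : Prop :=
  (C z x y ∧ C t x y) ∨ (C x z t ∧ C y z t)

/-- The restriction `Q_d` of the quartet relation to quadruples of pairwise distinct
elements. -/
def QdRel {L : Type} (C : L → L → L → Prop) (x y z t : L) : Prop :=
  x ≠ y ∧ x ≠ z ∧ x ≠ t ∧ y ≠ z ∧ y ≠ t ∧ z ≠ t ∧ QRel C x y z t

/-- The structure `(L; C)` with a single ternary relation. -/
def CStruct {L : Type} (C : L → L → L → Prop) : RelStruct Unit (fun _ => 3) L where
  rel := fun _ t => C (t 0) (t 1) (t 2)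

/-- The structure `(L; N)` with a single ternary relation. -/
def NStruct {L : Type} (C : L → L → L → Prop) : RelStruct Unit (fun _ => 3) L where
  rel := fun _ t => NRel C (t 0) (t 1) (t 2)

/-- The structure `(L; Q_d)` with a single quaternary relation. -/
def QdStruct {L : Type} (C : L → L → L → Prop) : RelStruct Unit (fun _ => 4) L where
  rel := fun _ t => QdRel C (t 0) (t 1) (t 2) (t 3)
section NAEaux
variable {L : Type} {C : L → L → L → Prop}

theorem crel_lift (h : IsCRelation C) {b x a y : L} (hx : C b x a) (hy : C b y a) :
    C b x y := by
  obtain ⟨h1, h2, h3, h4⟩ := h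
  grind

theorem crel_cross (h : IsCRelation C) {b x a y : L} (hx : C b x a) (hy : C a y b) :
    C y x a := by
  obtain ⟨h1, h2, h3, h4⟩ := h
  grind

/-- `x` and `y` lie in different cones below the meet of `a` and `b`. -/
def NAEneq (C : L → L → L → Prop) (a b x y : L) : Prop :=
  NRel C x a y ∧ NRel C x b y

theorem naeneq_iff (h : IsCRelation C) {a b x y : L}
    (hx : NRel C a x b) (hy : NRel C a y b) :
    NAEneq C a b x y ↔ ¬ (C a x b ↔ C a y b) := by
  have k1 := @crel_lift L C h
  have k2 := @crel_cross L C h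
  obtain ⟨h1, h2, h3, h4⟩ := h
  unfold NAEneq NRel at *
  rcases hx with hx | hx <;> rcases hy with hy | hy <;> grind

theorem n_cross (h : IsCRelation C) {a b x y z : L}
    (hx : NRel C a x b) (hy : NRel C a y b) (hz : NRel C a z b) (hN : NRel C x y z) :
    ¬ ((C a x b ↔ C a z b) ∧ ¬ (C a y b ↔ C a x b)) := by
  have k1 := @crel_lift L C h
  have k2 := @crel_cross L C h
  obtain ⟨h1, h2, h3, h4⟩ := h
  unfold NRel at *
  rcases hx with hx | hx <;> rcases hy with hy | hy <;> rcases hz with hz | hz <;> grind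

theorem n_cross' (h : IsCRelation C) {a b x y z : L}
    (hx : NRel C a x b) (hy : NRel C a y b) (hz : NRel C a z b)
    (hxz : ¬ (C a x b ↔ C a z b)) : NRel C x y z := by
  have k1 := @crel_lift L C h
  have k2 := @crel_cross L C h
  obtain ⟨h1, h2, h3, h4⟩ := h
  unfold NRel at *
  rcases hx with hx | hx <;> rcases hy with hy | hy <;> rcases hz with hz | hz <;> grind

theorem cone_other (h : IsCRelation C) (hd : IsDenseC C) {a b y : L}
    (hy : NRel C a y b) : ∃ w, NRel C a w b ∧ (C a w b ↔ C a y b) ∧ NRel C y y w := by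
  have k1 := @crel_lift L C h
  have k2 := @crel_cross L C h
  obtain ⟨h1, h2, h3, h4⟩ := h
  unfold NRel at *
  rcases hy with hy | hy
  · obtain ⟨w, hw, hw'⟩ := hd b y y (h4 _ _ (by rintro rfl; grind))
    exact ⟨w, by grind, by grind, by grind⟩
  · obtain ⟨w, hw, hw'⟩ := hd a y y (h4 _ _ (by rintro rfl; grind))
    exact ⟨w, by grind, by grind, by grind⟩

theorem cone_ends (h : IsCRelation C) {a b : L} (hab : a ≠ b) :
    NRel C a a b ∧ NRel C a b b ∧ ¬ C a a b ∧ C a b b := by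
  obtain ⟨h1, h2, h3, h4⟩ := h
  unfold NRel
  grind

theorem eq_char (h : IsCRelation C) {a b : L} (hab : a ≠ b) {x y : L}
    (hx : NRel C a x b) (hy : NRel C a y b) :
    (C a x b ↔ C a y b) ↔
      ∃ z, NRel C a z b ∧ NAEneq C a b x z ∧ NAEneq C a b y z := by
  obtain ⟨e1, e2, e3, e4⟩ := cone_ends h hab
  constructor
  · intro hxy
    by_cases hb : C a x b
    · exact ⟨a, e1, (naeneq_iff h hx e1).2 (by tauto), (naeneq_iff h hy e1).2 (by tauto)⟩
    · exact ⟨b, e2, (naeneq_iff h hx e2).2 (by tauto), (naeneq_iff h hy e2).2 (by tauto)⟩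
  · rintro ⟨z, hz, h1, h2⟩
    rw [naeneq_iff h hx hz] at h1
    rw [naeneq_iff h hy hz] at h2
    tauto

theorem nae_char (h : IsCRelation C) (hd : IsDenseC C) {a b : L} (hab : a ≠ b) {x y z : L}
    (hx : NRel C a x b) (hy : NRel C a y b) (hz : NRel C a z b) :
    ¬ ((C a x b ↔ C a y b) ∧ (C a y b ↔ C a z b)) ↔
      ∃ x' z', NRel C a x' b ∧ NRel C a z' b ∧ NAEneq C a b x x' ∧ NAEneq C a b z z' ∧
        NRel C x' y z' := by
  have opp : ∀ u, NRel C a u b → ∃ u', NRel C a u' b ∧ ¬ (C a u b ↔ C a u' b) := by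
    obtain ⟨e1, e2, e3, e4⟩ := cone_ends h hab
    intro u hu
    by_cases hb : C a u b
    · exact ⟨a, e1, by tauto⟩
    · exact ⟨b, e2, by tauto⟩
  constructor
  · intro hn
    by_cases hxz : C a x b ↔ C a z b
    · obtain ⟨w, w1, w2, w3⟩ := cone_other h hd hy
      exact ⟨y, w, hy, w1, (naeneq_iff h hx hy).2 (by tauto),
        (naeneq_iff h hz w1).2 (by tauto), w3⟩
    · obtain ⟨x', x1, x2⟩ := opp x hx
      obtain ⟨z', z1, z2⟩ := opp z hz
      exact ⟨x', z', x1, z1, (naeneq_iff h hx x1).2 x2, (naeneq_iff h hz z1).2 z2,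
        n_cross' h x1 hy z1 (by tauto)⟩
  · rintro ⟨x', z', x1, z1, x2, z2, hN⟩
    have := n_cross h x1 hy z1 hN
    rw [naeneq_iff h hx x1] at x2
    rw [naeneq_iff h hz z1] at z2
    tauto

/-- The atomic formula `N(i,j,k)`. -/
def fN {n : ℕ} (i j k : Fin n) :
    PPFormula (Unit ⊕ Fin 2) (Sum.elim (fun _ => 3) fun _ => 1) n :=
  .rel (.inl ()) (![i, j, k] : Fin 3 → Fin n)

/-- The atomic formula saying that variable `i` is the constant number `c`. -/
def fK {n : ℕ} (c : Fin 2) (i : Fin n) :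
    PPFormula (Unit ⊕ Fin 2) (Sum.elim (fun _ => 3) fun _ => 1) n :=
  .rel (.inr c) (![i] : Fin 1 → Fin n)

def domF : PPFormula (Unit ⊕ Fin 2) (Sum.elim (fun _ => 3) fun _ => 1) 1 :=
  .ex (.ex (.and (fK 0 1) (.and (fK 1 2) (fN 1 0 2))))

def eqF : PPFormula (Unit ⊕ Fin 2) (Sum.elim (fun _ => 3) fun _ => 1) 2 :=
  .ex (.ex (.and (fK 0 2) (.and (fK 1 3) (.ex (.and (fN 2 4 3)
    (.and (.and (fN 0 2 4) (fN 0 3 4)) (.and (fN 1 2 4) (fN 1 3 4))))))))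

def naeF : PPFormula (Unit ⊕ Fin 2) (Sum.elim (fun _ => 3) fun _ => 1) 3 :=
  .ex (.ex (.and (fK 0 3) (.and (fK 1 4) (.ex (.ex (.and (fN 3 5 4) (.and (fN 3 6 4)
    (.and (.and (fN 0 3 5) (fN 0 4 5)) (.and (.and (fN 2 3 6) (fN 2 4 6))
      (fN 5 1 6))))))))))

theorem ex_const {a b : L} {P : L → L → Prop} :
    (∃ u v, u = a ∧ v = b ∧ P u v) ↔ P a b := by
  constructor
  · rintro ⟨_, _, rfl, rfl, h⟩
    exact h
  · intro h
    exact ⟨a, b, rfl, rfl, h⟩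

theorem domF_iff (a b : L) (t : Fin 1 → L) :
    domF.Realize ((NStruct C).withConstants ![a, b]) t ↔ NRel C a (t 0) b :=
  ex_const (P := fun u v => NRel C u (t 0) v)

theorem eqF_iff (a b : L) (t : Fin 2 → L) :
    eqF.Realize ((NStruct C).withConstants ![a, b]) t ↔
      ∃ z, NRel C a z b ∧ NAEneq C a b (t 0) z ∧ NAEneq C a b (t 1) z :=
  ex_const (P := fun a b => ∃ z, NRel C a z b ∧ NAEneq C a b (t 0) z ∧ NAEneq C a b (t 1) z)

theorem naeF_iff (a b : L) (t : Fin 3 → L) :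
    naeF.Realize ((NStruct C).withConstants ![a, b]) t ↔
      ∃ x' z', NRel C a x' b ∧ NRel C a z' b ∧ NAEneq C a b (t 0) x' ∧
        NAEneq C a b (t 2) z' ∧ NRel C x' (t 1) z' :=
  ex_const (P := fun a b => ∃ x' z', NRel C a x' b ∧ NRel C a z' b ∧ NAEneq C a b (t 0) x' ∧
        NAEneq C a b (t 2) z' ∧ NRel C x' (t 1) z')

end NAEaux

/-- **Proposition (NAE from N with two constants).**
Let `a, b` be arbitrary distinct elements of `𝕃`. Then `({0,1}; NAE)` has a primitive
positive interpretation in `(𝕃; N, a, b)`, the expansion of `(𝕃; N)` by the constants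
`a` and `b`. -/
theorem NAE_pp_interpretable_in_N_with_constants
    (L : Type) (C : L → L → L → Prop) (hL : IsHomBBDenseC C)
    (a b : L) (hab : a ≠ b) :
    Nonempty (PPInterpretation ((NStruct C).withConstants ![a, b]) NAEStruct) := by
  classical
  obtain ⟨-, -, hC, -, hd, -⟩ := hL
  refine ⟨{
    dim := 1
    domFml := domF
    eqFml := eqF
    relFml := fun _ => naeF
    coord := fun t => decide (C a (t 0) b)
    coord_surj := ?_
    eq_iff := ?_
    rel_iff := ?_ }⟩
  · obtain ⟨e1, e2, e3, e4⟩ := cone_ends hC hab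
    rintro (_ | _)
    · exact ⟨fun _ => a, (domF_iff a b _).2 e1, by simpa using e3⟩
    · exact ⟨fun _ => b, (domF_iff a b _).2 e2, by simpa using e4⟩
  · intro t₁ t₂ h₁ h₂
    rw [domF_iff] at h₁ h₂
    rw [decide_eq_decide, eq_char hC hab h₁ h₂]
    exact (eqF_iff a b (flattenTuple ![t₁, t₂])).symm
  · intro s ts hts
    have h0 := (domF_iff a b _).1 (hts (0 : Fin 3))
    have h1 := (domF_iff a b _).1 (hts (1 : Fin 3))
    have h2 := (domF_iff a b _).1 (hts (2 : Fin 3))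
    refine Iff.trans ?_ ((nae_char hC hd hab h0 h1 h2).trans
      (naeF_iff a b (flattenTuple ts)).symm)
    change ((∃ i : Fin 3, decide (C a (ts i 0) b) = true) ∧
      (∃ i : Fin 3, decide (C a (ts i 0) b) = false)) ↔ _
    simp only [Fin.exists_fin_succ, decide_eq_true_eq, decide_eq_false_iff_not]
    simp
    tauto
end

section
/- Let a, b, c be three pairwise distinct elements of 𝕃. Then the structure ({0,1}; NAE) has a primitive positive interpretation in the structure (𝕃; Q_d, a, b, c), the expansion of (𝕃;Q_d) by the constants a, b, c. -/
structure DAx {L : Type} (Q : L → L → L → L → Prop) : Prop where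
  ne : ∀ {a b c d}, Q a b c d → a ≠ b ∧ a ≠ c ∧ a ≠ d ∧ b ≠ c ∧ b ≠ d ∧ c ≠ d
  s1 : ∀ {a b c d}, Q a b c d → Q b a c d
  s2 : ∀ {a b c d}, Q a b c d → Q c d a b
  ex : ∀ {a b c d}, Q a b c d → ¬ Q a c b d
  tot : ∀ {a b c d}, a ≠ b → a ≠ c → a ≠ d → b ≠ c → b ≠ d → c ≠ d →
    Q a b c d ∨ Q a c b d ∨ Q a d b c
  d5 : ∀ {a b c d e}, Q a b c d → e ≠ a → e ≠ b → e ≠ c → e ≠ d → Q a b c e ∨ Q e b c d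
  near : ∀ {a b c}, a ≠ b → a ≠ c → b ≠ c → ∃ u, Q u a b c
  mid : ∀ {a b c d}, Q a b c d → ∃ u, Q a b u c ∧ Q a b u d ∧ Q a u c d ∧ Q b u c d

theorem DAx_of {L : Type} {C : L → L → L → Prop} (hL : IsHomBBDenseC C) : DAx (QdRel C) := by
  obtain ⟨-, -, ⟨c1, c2, c3, c4⟩, bb, dn, -⟩ := hL
  have n1 : ∀ {z x y}, C z x y → z ≠ x := by
    rintro z x y h rfl
    by_cases e : z = y
    · subst e; exact c2 _ _ _ h h
    · exact c2 _ _ _ h (c4 _ _ e)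
  have n2 : ∀ {z x y}, C z x y → z ≠ y := fun h => n1 (c1 _ _ _ h)
  have midh : ∀ {a b c d}, a ≠ b → c ≠ d → C c a b → C d a b → 
      ∃ u, QdRel C a b u c ∧ QdRel C a b u d ∧ QdRel C a u c d ∧ QdRel C b u c d := by
    intro a b c d hab hcd h1 h2
    have key : ∃ u, C u a b ∧ C c u b ∧ C d u b := by
      rcases bb b c d (n2 h1).symm (n2 h2).symm hcd with h | h | h
      · obtain ⟨w, hw, hw'⟩ := dn _ _ _ h1
        exact ⟨w, hw', hw, by grind⟩
      · obtain ⟨w, hw, hw'⟩ := dn _ _ _ h2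
        exact ⟨w, hw', by grind, hw⟩
      · obtain ⟨w, hw, hw'⟩ := dn _ _ _ h1
        exact ⟨w, hw', hw, by grind⟩
    obtain ⟨u, hu1, hu2, hu3⟩ := key
    have hu4 : C c a u := by grind
    have hu5 : C d a u := by grind
    have := n1 h1; have := n2 h1; have := n1 h2; have := n2 h2
    have := n1 hu1; have := n2 hu1; have := n1 hu2; have := n1 hu3
    refine ⟨u, ?_, ?_, ?_, ?_⟩ <;> simp only [QdRel, QRel] <;> grind
  constructor
  · rintro a b c d ⟨h1, h2, h3, h4, h5, h6, -⟩; exact ⟨h1, h2, h3, h4, h5, h6⟩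
  · rintro a b c d ⟨h1, h2, h3, h4, h5, h6, h⟩; simp only [QdRel, QRel] at *; grind
  · rintro a b c d ⟨h1, h2, h3, h4, h5, h6, h⟩; simp only [QdRel, QRel] at *; grind
  · rintro a b c d ⟨h1, h2, h3, h4, h5, h6, h⟩ ⟨-, -, -, -, -, -, h'⟩; simp only [QRel] at *; grind
  · rintro a b c d h1 h2 h3 h4 h5 h6; simp only [QdRel, QRel] at *
    have := bb a b c h1 h2 h4
    have := bb a b d h1 h3 h5
    have := bb a c d h2 h3 h6
    have := bb b c d h4 h5 h6
    grind
  · rintro a b c d e ⟨h1, h2, h3, h4, h5, h6, h⟩ g1 g2 g3 g4; simp only [QdRel, QRel] at *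
    have := bb a b e h1 g1.symm g2.symm
    have := bb c d e h6 g3.symm g4.symm
    grind
  · intro a b c h1 h2 h3
    have key : ∃ u, u ≠ a ∧ C b u a ∧ C c u a := by
      rcases bb a b c h1 h2 h3 with h | h | h
      · obtain ⟨w, hw, hw'⟩ := dn _ _ _ (c4 b a h1)
        exact ⟨w, n1 hw', hw, by grind⟩
      · obtain ⟨w, hw, hw'⟩ := dn _ _ _ (c4 c a h2)
        exact ⟨w, n1 hw', by grind, hw⟩
      · obtain ⟨w, hw, hw'⟩ := dn _ _ _ (c4 b a h1)
        exact ⟨w, n1 hw', hw, by grind⟩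
    obtain ⟨u, hu, hu1, hu2⟩ := key
    exact ⟨u, hu, (n1 hu1).symm, (n1 hu2).symm, h1, h2, h3, Or.inl ⟨hu1, hu2⟩⟩
  · rintro a b c d ⟨h1, h2, h3, h4, h5, h6, ⟨h, h'⟩ | ⟨h, h'⟩⟩
    · exact midh h1 h6 h h'
    · obtain ⟨u, hu1, hu2, hu3, hu4⟩ := midh h6 h1 h h'
      refine ⟨u, ?_, ?_, ?_, ?_⟩ <;> simp only [QdRel, QRel] at * <;> grind

theorem DAx.l1 {L : Type} {Q : L → L → L → L → Prop} (h : DAx Q) {a b c x v : L}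
    (h1 : Q a b c x) (h2 : Q a c x v) (hbv : b ≠ v) : Q a b x v := by
  have := h.ne h1
  have := h.ne h2
  rcases h.d5 (h.s1 (h.s2 h1)) (e := v) (by grind) (by grind) (by grind) (by grind) with h3 | h3
  · exact absurd (h.d5 h3 (e := b)) (by
      have := h.ex (h.s2 h2)
      have a1 := h.s1 h3
      have a2 := h.ex h1
      have a3 := h.s2 h1
      have a4 := h.ex h2
      have a5 := h.d5 (h.s2 h2) (e := b) (by grind) (by grind) (by grind) (by grind)
      have b1 := @h.s1
      have b2 := @h.s2
      have b3 := @h.ex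
      grind)
  · have b1 := @h.s1
    have b2 := @h.s2
    have b3 := @h.ex
    have b5 := @h.d5
    grind

theorem DAx.l2 {L : Type} {Q : L → L → L → L → Prop} (h : DAx Q) {a b x u v : L}
    (h1 : Q a b x u) (h2 : Q a b x v) (huv : u ≠ v) : Q a b u v := by
  have := h.ne h1
  have := h.ne h2
  rcases h.d5 (h.s1 (h.s2 h1)) (e := v) (by grind) (by grind) (by grind) (by grind) with h3 | h3
  · have b1 := @h.s1
    have b2 := @h.s2
    have b3 := @h.ex
    have b5 := @h.d5
    grind
  · have b1 := @h.s1
    have b2 := @h.s2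
    have b3 := @h.ex
    have b5 := @h.d5
    grind

def NNr {L : Type} (Q : L → L → L → L → Prop) (c x y z : L) : Prop :=
  x ≠ y ∧ x ≠ z ∧ y ≠ z ∧ x ≠ c ∧ y ≠ c ∧ z ≠ c ∧ ¬ Q x z y c

theorem DAx.s3 {L : Type} {Q : L → L → L → L → Prop} (h : DAx Q) {a b c d : L}
    (h1 : Q a b c d) : Q a b d c := h.s2 (h.s1 (h.s2 h1))

theorem DAx.nn_aux {L : Type} {Q : L → L → L → L → Prop} (h : DAx Q) {c x y z : L}
    (h1 : Q x y z c) : ∃ u v, Q z c y u ∧ Q x v z u ∧ Q x c y v := by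
  have hn := h.ne h1
  obtain ⟨u, u1, u2, u3, u4⟩ := h.mid h1
  obtain ⟨v, v1⟩ := h.near (a := y) (b := x) (c := c) (by grind) (by grind) (by grind)
  have hu := h.ne u1
  have hv := h.ne v1
  have hvz : v ≠ z := by
    rintro rfl
    exact h.ex (h.s1 h1) (h.s1 v1)
  have hvu : v ≠ u := by
    rintro rfl
    exact h.ex (h.s1 u2) (h.s1 v1)
  refine ⟨u, v, h.s2 u4, ?_, h.s3 (h.s2 v1)⟩
  have w1 : Q y v x c := h.s1 v1
  have w2 : Q y v c u := h.l1 w1 (h.s3 (h.s1 u2)) hvu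
  have w3 : Q y v x u := h.l2 (h.s3 w1) w2 (by grind)
  have w4 : Q y v u z := h.l1 w3 (h.s1 u1) hvz
  have w5 : Q z u v x := h.l2 (h.s1 (h.s2 w4)) (h.s1 (h.s2 (h.s1 u1))) (by grind)
  exact h.s1 (h.s2 w5)

theorem DAx.nn_iff {L : Type} {Q : L → L → L → L → Prop} (h : DAx Q) {c x y z : L} :
    NNr Q c x y z ↔ ∃ u v, Q z c y u ∧ Q x v z u ∧ Q x c y v := by
  constructor
  · rintro ⟨h1, h2, h3, h4, h5, h6, h7⟩
    rcases h.tot h1 h2 h4 h3 h5 h6 with k | k | k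
    · exact h.nn_aux k
    · exact absurd k h7
    · obtain ⟨u, v, a1, a2, a3⟩ := h.nn_aux (h.s1 (h.s2 k))
      exact ⟨v, u, a3, h.s2 a2, a1⟩
  · rintro ⟨u, v, a1, a2, a3⟩
    have n1 := h.ne a1
    have n2 := h.ne a2
    have n3 := h.ne a3
    refine ⟨by grind, by grind, by grind, by grind, by grind, by grind, fun k => ?_⟩
    have w1 : Q x z y v := h.l1 (h.s3 k) a3 (by grind)
    have w2 : Q z x y u := h.l1 (h.s1 (h.s3 k)) a1 (by grind)
    exact h.ex (h.l2 w1 (h.s1 w2) (by grind)) a2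

theorem DAx.same {L : Type} {Q : L → L → L → L → Prop} (h : DAx Q) {a b c x y : L}
    (h1 : Q a x b c) (h2 : Q a y b c) (hxy : x ≠ y) : Q x y b c :=
  h.s2 (h.l2 (h.s2 h1) (h.s2 h2) hxy)

theorem DAx.diff {L : Type} {Q : L → L → L → L → Prop} (h : DAx Q) {a b c x y : L}
    (h1 : Q a x b c) (h2 : Q b y a c) : x ≠ y ∧ Q a x y c := by
  have hxy : x ≠ y := by
    rintro rfl
    exact h.ex (h.s1 h1) (h.s1 h2)
  have w1 : Q a x b y := h.l1 (h.s3 h1) (h.s2 h2) hxy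
  have n1 := h.ne h1
  have n2 := h.ne h2
  exact ⟨hxy, h.l2 w1 h1 (by grind)⟩

/-- `x` is on the side of `a` -/
def Sd {L : Type} (Q : L → L → L → L → Prop) (a b c : L) (s : Bool) (x : L) : Prop :=
  bif s then Q a x b c else Q b x a c

theorem DAx.sd_same {L : Type} {Q : L → L → L → L → Prop} (h : DAx Q) {a b c x y p : L} {s : Bool}
    (h1 : Sd Q a b c s x) (h2 : Sd Q a b c s y) (h3 : Sd Q a b c (!s) p) (hxy : x ≠ y) :
    Q x y p c := by
  have main : ∀ {a b}, Q a x b c → Q a y b c → Q b p a c → Q x y p c := by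
    intro a b k1 k2 k3
    have w1 := (h.diff k1 k3).2
    have w2 := (h.diff k2 k3).2
    exact h.same w1 w2 hxy
  cases s
  · exact main h1 h2 h3
  · exact main h1 h2 h3

theorem DAx.sd_uniq {L : Type} {Q : L → L → L → L → Prop} (h : DAx Q) {a b c x : L} {s t : Bool}
    (h1 : Sd Q a b c s x) (h2 : Sd Q a b c t x) : s = t := by
  cases s <;> cases t <;> simp only [Sd, cond_true, cond_false] at *
  · exact ((h.diff h1 h2).1 rfl).elim
  · exact ((h.diff h1 h2).1 rfl).elim

def Dm {L : Type} (Q : L → L → L → L → Prop) (a b c x : L) : Prop := NNr Q c a x b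

theorem DAx.dm_iff {L : Type} {Q : L → L → L → L → Prop} (h : DAx Q) {a b c x : L} :
    Dm Q a b c x ↔ ∃ s, Sd Q a b c s x := by
  constructor
  · rintro ⟨h1, h2, h3, h4, h5, h6, h7⟩
    rcases h.tot h1 h2 h4 h3 h5 h6 with k | k | k
    · exact ⟨true, k⟩
    · exact absurd k h7
    · exact ⟨false, h.s1 (h.s2 k)⟩
  · rintro ⟨s, hs⟩
    cases s
    · have hs : Q b x a c := hs
      have := h.ne hs
      exact ⟨by grind, by grind, by grind, by grind, by grind, by grind, fun k =>
        h.ex hs (h.s1 k)⟩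
    · have hs : Q a x b c := hs
      have := h.ne hs
      exact ⟨by grind, by grind, by grind, by grind, by grind, by grind, fun k => h.ex hs k⟩

def Op {L : Type} (Q : L → L → L → L → Prop) (a b c x y : L) : Prop :=
  NNr Q c x a y ∧ NNr Q c x b y

theorem DAx.op_iff {L : Type} {Q : L → L → L → L → Prop} (h : DAx Q) {a b c x y : L} {s t : Bool}
    (hx : Sd Q a b c s x) (hy : Sd Q a b c t y) : Op Q a b c x y ↔ s ≠ t := by
  have same1 : ∀ {a b}, Q a x b c → Q a y b c → ¬ NNr Q c x b y := by
    intro a b k1 k2 k3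
    exact k3.2.2.2.2.2.2 (h.same k1 k2 k3.2.1)
  have diff1 : ∀ {a b}, Q a x b c → Q b y a c → NNr Q c x a y ∧ NNr Q c x b y := by
    intro a b k1 k2
    have n1 := h.ne k1
    have n2 := h.ne k2
    obtain ⟨e, w⟩ := h.diff k1 k2
    obtain ⟨e', w'⟩ := h.diff k2 k1
    refine ⟨⟨by grind, by grind, by grind, by grind, by grind, by grind, fun k => ?_⟩,
      ⟨by grind, by grind, by grind, by grind, by grind, by grind, fun k => ?_⟩⟩
    · exact h.ex k (h.s1 w)
    · exact h.ex (h.s1 k) (h.s1 w')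
  cases s <;> cases t <;> simp only [Sd, Op, cond_true, cond_false] at *
  · have := same1 hx hy; tauto
  · have := diff1 hx hy; tauto
  · have := diff1 hx hy; tauto
  · have := same1 hx hy; tauto

theorem DAx.exists_three {L : Type} {Q : L → L → L → L → Prop} (h : DAx Q) {a b c : L}
    (hab : a ≠ b) (hac : a ≠ c) (hbc : b ≠ c) (s : Bool) :
    ∃ p q r, Sd Q a b c s p ∧ Sd Q a b c s q ∧ Sd Q a b c s r ∧ NNr Q c p q r := by
  have main : ∀ {a b : L}, a ≠ b → a ≠ c → b ≠ c →
      ∃ p q r, Q a p b c ∧ Q a q b c ∧ Q a r b c ∧ NNr Q c p q r := by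
    intro a b hab hac hbc
    obtain ⟨p, hp⟩ := h.near hab hac hbc
    have hp := h.s1 hp
    obtain ⟨u, u1, u2, u3, u4⟩ := h.mid hp
    obtain ⟨v, v1, v2, v3, v4⟩ := h.mid u2
    have n1 := h.ne hp
    have n2 := h.ne u1
    have n3 := h.ne v1
    have n4 := h.ne v2
    have n5 := h.ne v3
    have hvb : v ≠ b := by
      rintro rfl
      exact h.ex v3 u3
    have w : Q a v b c := h.s2 (by
      have w1 : Q u c a v := h.s2 v3
      have w2 : Q a v c b := h.l1 v3 (h.s3 u3) hvb
      exact h.s2 (h.s3 w2))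
    refine ⟨p, v, u, hp, w, u3, by grind, by grind, by grind, by grind, by grind, by grind,
      fun k => h.ex k v4⟩
  cases s
  · exact main hab.symm hbc hac
  · exact main hab hac hbc

def Eqv {L : Type} (Q : L → L → L → L → Prop) (a b c x y : L) : Prop :=
  ∃ z, Dm Q a b c z ∧ Op Q a b c x z ∧ Op Q a b c z y

def NAEf {L : Type} (Q : L → L → L → L → Prop) (a b c x y z : L) : Prop :=
  ∃ x', ∃ y', ∃ p, Dm Q a b c x' ∧ Dm Q a b c y' ∧ Dm Q a b c p ∧ Eqv Q a b c x x' ∧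
    Eqv Q a b c y y' ∧ NNr Q c x' p y' ∧ Op Q a b c p z

theorem DAx.eqv_iff {L : Type} {Q : L → L → L → L → Prop} (h : DAx Q) {a b c : L}
    (hab : a ≠ b) (hac : a ≠ c) (hbc : b ≠ c) {x y : L} {s t : Bool}
    (hx : Sd Q a b c s x) (hy : Sd Q a b c t y) : Eqv Q a b c x y ↔ s = t := by
  constructor
  · rintro ⟨z, hz, h1, h2⟩
    obtain ⟨r, hr⟩ := h.dm_iff.1 hz
    rw [h.op_iff hx hr] at h1
    rw [h.op_iff hr hy] at h2
    cases r <;> cases s <;> cases t <;> simp_all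
  · rintro rfl
    obtain ⟨p, -, -, hp, -⟩ := h.exists_three hab hac hbc (!s)
    refine ⟨p, h.dm_iff.2 ⟨_, hp⟩, (h.op_iff hx hp).2 (by simp), (h.op_iff hp hy).2 (by simp)⟩

theorem DAx.nae_iff {L : Type} {Q : L → L → L → L → Prop} (h : DAx Q) {a b c : L}
    (hab : a ≠ b) (hac : a ≠ c) (hbc : b ≠ c) {x y z : L} {s t r : Bool}
    (hx : Sd Q a b c s x) (hy : Sd Q a b c t y) (hz : Sd Q a b c r z) :
    NAEf Q a b c x y z ↔ ¬ (s = t ∧ t = r) := by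
  constructor
  · rintro ⟨x', y', p, hx', hy', hp, h1, h2, h3, h4⟩ ⟨rfl, rfl⟩
    obtain ⟨_, hx'⟩ := h.dm_iff.1 hx'
    obtain ⟨_, hy'⟩ := h.dm_iff.1 hy'
    obtain ⟨q, hp⟩ := h.dm_iff.1 hp
    rw [h.eqv_iff hab hac hbc hx hx'] at h1
    rw [h.eqv_iff hab hac hbc hy hy'] at h2
    subst h1 h2
    rw [h.op_iff hp hz] at h4
    have : q = !s := by cases q <;> cases s <;> simp_all
    subst this
    exact h3.2.2.2.2.2.2 (h.sd_same hx' hy' hp h3.2.1)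
  · intro hne
    by_cases e : s = t
    · subst e
      obtain ⟨p, q, w, hp, hq, hw, hn⟩ := h.exists_three hab hac hbc s
      refine ⟨p, w, q, h.dm_iff.2 ⟨_, hp⟩, h.dm_iff.2 ⟨_, hw⟩, h.dm_iff.2 ⟨_, hq⟩,
        (h.eqv_iff hab hac hbc hx hp).2 rfl, (h.eqv_iff hab hac hbc hy hw).2 rfl, hn,
        (h.op_iff hq hz).2 (by tauto)⟩
    · have key : ∀ {x' p y' : L} {s : Bool}, Sd Q a b c s x' → Sd Q a b c s p →
          Sd Q a b c (!s) y' → x' ≠ p → NNr Q c x' p y' ∧ NNr Q c y' p x' := by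
        intro x' p y' s k1 k2 k3 k4
        have w := h.sd_same k1 k2 k3 k4
        have n := h.ne w
        refine ⟨⟨by grind, by grind, by grind, by grind, by grind, by grind, fun k => ?_⟩,
          ⟨by grind, by grind, by grind, by grind, by grind, by grind, fun k => ?_⟩⟩
        · exact h.ex k w
        · exact h.ex (h.s1 k) w
      have ht : t = !s := by cases s <;> cases t <;> simp_all
      subst ht
      obtain ⟨p, q, w, hp, hq, hw, hn⟩ := h.exists_three hab hac hbc (!r)
      by_cases e' : s = !r
      · subst e'
        refine ⟨p, y, q, h.dm_iff.2 ⟨_, hp⟩, h.dm_iff.2 ⟨_, hy⟩, h.dm_iff.2 ⟨_, hq⟩,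
          (h.eqv_iff hab hac hbc hx hp).2 rfl, (h.eqv_iff hab hac hbc hy hy).2 rfl,
          (key hp hq hy hn.1).1, (h.op_iff hq hz).2 (by simp)⟩
      · have : s = r := by cases s <;> cases r <;> simp_all
        subst this
        refine ⟨x, p, q, h.dm_iff.2 ⟨_, hx⟩, h.dm_iff.2 ⟨_, hp⟩, h.dm_iff.2 ⟨_, hq⟩,
          (h.eqv_iff hab hac hbc hx hx).2 rfl, (h.eqv_iff hab hac hbc hy hp).2 rfl,
          (key hp hq (by simpa using hx) hn.1).2, (h.op_iff hq hz).2 (by simp)⟩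

section
variable {σ : Type} {ar : σ → ℕ} {D : Type} {Γ : RelStruct σ ar D}

theorem pp_and {n : ℕ} {P R : (Fin n → D) → Prop} (h1 : PPDefinable Γ P) (h2 : PPDefinable Γ R) :
    PPDefinable Γ (fun t => P t ∧ R t) := by
  obtain ⟨φ, hφ⟩ := h1
  obtain ⟨ψ, hψ⟩ := h2
  exact ⟨.and φ ψ, fun t => by simp only [PPFormula.Realize, hφ, hψ]⟩

theorem pp_ex {n : ℕ} {P : (Fin n → D) → D → Prop}
    (h1 : PPDefinable Γ (fun t : Fin (n+1) → D => P (fun i => t i.castSucc) (t (Fin.last n)))) :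
    PPDefinable Γ (fun t => ∃ d, P t d) := by
  obtain ⟨φ, hφ⟩ := h1
  refine ⟨.ex φ, fun t => ?_⟩
  simp only [PPFormula.Realize, ← hφ]
  simp

/-- relations of arity 1, 2, 3, closed under substitution -/
def PP1 (Γ : RelStruct σ ar D) (P : D → Prop) : Prop := 
  ∀ ⦃n : ℕ⦄ (i : Fin n), PPDefinable Γ (fun t => P (t i))
def PP2 (Γ : RelStruct σ ar D) (P : D → D → Prop) : Prop := 
  ∀ ⦃n : ℕ⦄ (i j : Fin n), PPDefinable Γ (fun t => P (t i) (t j))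
def PP3 (Γ : RelStruct σ ar D) (P : D → D → D → Prop) : Prop := 
  ∀ ⦃n : ℕ⦄ (i j k : Fin n), PPDefinable Γ (fun t => P (t i) (t j) (t k))
def PP4 (Γ : RelStruct σ ar D) (P : D → D → D → D → Prop) : Prop := 
  ∀ ⦃n : ℕ⦄ (i j k l : Fin n), PPDefinable Γ (fun t => P (t i) (t j) (t k) (t l))

theorem pp_const {n : ℕ} {a : D} (ha : PP1 Γ (fun x => x = a)) {P : (Fin n → D) → D → Prop}
    (h1 : PPDefinable Γ (fun t : Fin (n+1) → D => P (fun i => t i.castSucc) (t (Fin.last n)))) :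
    PPDefinable Γ (fun t => P t a) := by
  have : (fun t => P t a) = (fun t => ∃ d, d = a ∧ P t d) := by
    funext t; simp
  rw [this]
  exact pp_ex (P := fun t d => d = a ∧ P t d) (pp_and (ha _) h1)
end

section
variable {σ : Type} {ar : σ → ℕ} {L : Type} {Γ : RelStruct σ ar L} {Q : L → L → L → L → Prop}
  {a b c : L}

theorem pp_nn (h : DAx Q) (hQ : PP4 Γ Q) (hc : PP1 Γ (fun x => x = c)) :
    PP3 Γ (NNr Q c) := by
  intro n i j k
  simp only [h.nn_iff]
  apply pp_const (P := fun t c => ∃ u v, Q (t k) c (t j) u ∧ Q (t i) v (t k) u ∧ Q (t i) c (t j) v) hc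
  apply pp_ex
  apply pp_ex
  exact pp_and (hQ _ _ _ _) (pp_and (hQ _ _ _ _) (hQ _ _ _ _))

theorem pp_dm (hN : PP3 Γ (NNr Q c)) (ha : PP1 Γ (fun x => x = a)) (hb : PP1 Γ (fun x => x = b)) :
    PP1 Γ (Dm Q a b c) := by
  intro n i
  apply pp_const (P := fun t a => Dm Q a b c (t i)) ha
  apply pp_const (P := fun t b => Dm Q (t (Fin.last n)) b c (t i.castSucc)) hb
  exact hN _ _ _

theorem pp_op (hN : PP3 Γ (NNr Q c)) (ha : PP1 Γ (fun x => x = a)) (hb : PP1 Γ (fun x => x = b)) :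
    PP2 Γ (Op Q a b c) := by
  intro n i j
  apply pp_const (P := fun t a => Op Q a b c (t i) (t j)) ha
  apply pp_const (P := fun t b => Op Q (t (Fin.last n)) b c (t i.castSucc) (t j.castSucc)) hb
  exact pp_and (hN _ _ _) (hN _ _ _)

theorem pp_eqv (h1 : PP1 Γ (Dm Q a b c)) (h2 : PP2 Γ (Op Q a b c)) : PP2 Γ (Eqv Q a b c) := by
  intro n i j
  apply pp_ex
  exact pp_and (h1 _) (pp_and (h2 _ _) (h2 _ _))

theorem pp_nae (h0 : PP3 Γ (NNr Q c)) (h1 : PP1 Γ (Dm Q a b c)) (h2 : PP2 Γ (Op Q a b c))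
    (h3 : PP2 Γ (Eqv Q a b c)) : PP3 Γ (NAEf Q a b c) := by
  intro n i j k
  apply pp_ex
  apply pp_ex
  apply pp_ex
  exact pp_and (h1 _) (pp_and (h1 _) (pp_and (h1 _) (pp_and (h3 _ _) (pp_and (h3 _ _)
    (pp_and (h0 _ _ _) (h2 _ _))))))
end

/-- **Proposition (NAE from Q_d with three constants).**
Let `a, b, c` be three pairwise distinct elements of `𝕃`. Then `({0,1}; NAE)` has a
primitive positive interpretation in `(𝕃; Q_d, a, b, c)`, the expansion of `(𝕃; Q_d)`
by the constants `a, b, c`. -/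
theorem NAE_pp_interpretable_in_Qd_with_constants
    (L : Type) (C : L → L → L → Prop) (hL : IsHomBBDenseC C)
    (a b c : L) (hab : a ≠ b) (hac : a ≠ c) (hbc : b ≠ c) :
    Nonempty (PPInterpretation ((QdStruct C).withConstants ![a, b, c]) NAEStruct) := by
  have h := DAx_of hL
  set Q := QdRel C with hQdef
  set Γ := (QdStruct C).withConstants ![a, b, c] with hΓ
  have hQ : PP4 Γ Q := fun n i j k l => ⟨.rel (.inl ()) (![i, j, k, l] : Fin 4 → _), fun t => Iff.rfl⟩
  have ha : PP1 Γ (fun x => x = a) := fun n i => ⟨.rel (.inr 0) (![i] : Fin 1 → _), fun t => Iff.rfl⟩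
  have hb : PP1 Γ (fun x => x = b) := fun n i => ⟨.rel (.inr 1) (![i] : Fin 1 → _), fun t => Iff.rfl⟩
  have hc : PP1 Γ (fun x => x = c) := fun n i => ⟨.rel (.inr 2) (![i] : Fin 1 → _), fun t => Iff.rfl⟩
  have hN := pp_nn h hQ hc
  have hD := pp_dm hN ha hb
  have hO := pp_op hN ha hb
  have hE := pp_eqv hD hO
  have hA := pp_nae hN hD hO hE
  obtain ⟨φ, hφ⟩ := hD (n := 1) 0
  obtain ⟨ψ, hψ⟩ := hE (n := 2 * 1) 0 1
  obtain ⟨χ, hχ⟩ := hA (n := 3 * 1) 0 1 2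
  classical
  have hco : ∀ {x : L}, Dm Q a b c x → Sd Q a b c (decide (Q a x b c)) x := by
    intro x hx
    obtain ⟨s, hs⟩ := h.dm_iff.1 hx
    by_cases k : Q a x b c
    · simp [k, Sd]
    · cases s
      · simpa [k, Sd] using hs
      · exact absurd hs k
  refine ⟨⟨1, φ, ψ, fun _ => χ, fun t => decide (Q a (t 0) b c), ?_, ?_, ?_⟩⟩
  · intro e
    obtain ⟨p, -, -, hp, -⟩ := h.exists_three hab hac hbc e
    have hd : Dm Q a b c p := h.dm_iff.2 ⟨_, hp⟩
    exact ⟨fun _ => p, (hφ _).1 hd, h.sd_uniq (hco hd) hp⟩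
  · intro t₁ t₂ h1 h2
    rw [← hφ] at h1 h2
    rw [← hψ]
    exact (h.eqv_iff hab hac hbc (hco h1) (hco h2)).symm
  · intro s ts hts
    have hts' : ∀ i, Dm Q a b c (ts i 0) := fun i => (hφ _).2 (hts i)
    rw [← hχ]
    have key := h.nae_iff hab hac hbc (hco (hts' (0 : Fin 3))) (hco (hts' (1 : Fin 3)))
      (hco (hts' (2 : Fin 3)))
    refine Iff.trans ?_ key.symm
    have aux : ∀ f : Fin 3 → Bool, ((∃ i, f i = true) ∧ (∃ i, f i = false)) ↔
        ¬ (f 0 = f 1 ∧ f 1 = f 2) := by decide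
    exact aux (fun i => decide (Q a (ts i 0) b c))
end
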